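/- If w is a nonempty word such that www is a factor of the Tribonacci word 𝕋, then there exists m≥3 such that |w|=t_m. Conversely, for every m≥3 there exists a nonempty word w with |w|=t_m such that www is a factor of 𝕋. -/

import Mathlib

/-- The three-letter alphabet of the Tribonacci word. -/
inductive TLetter : Type
  | a | b | c
deriving DecidableEq

/-- The Tribonacci substitution σ(a)=ab, σ(b)=ac, σ(c)=a. -/
def tsubst : TLetter → List TLetter
  | .a => [.a, .b]
  | .b => [.a, .c]
  | .c => [.a]

/-- `Tword m = σ^m(a)`, the m-th finite Tribonacci word. -/
def Tword : ℕ → List TLetter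
  | 0 => [.a]
  | n + 1 => (Tword n).flatMap tsubst

/-- The prefix 𝕋[1,n] of the Tribonacci word of length n
(each `Tword n` is a prefix of the next and has length ≥ n). -/
def TPrefix (n : ℕ) : List TLetter := (Tword n).take n

/-- A word is a factor of the Tribonacci word 𝕋. -/
def IsFactorT (w : List TLetter) : Prop := ∃ m, w <:+: Tword m

/-- `tribAux i = t_{i-2}`: Tribonacci numbers, shifted so that the index is a natural. -/
def tribAux : ℕ → ℕ
  | 0 => 0
  | 1 => 1
  | 2 => 1
  | n + 3 => tribAux (n + 2) + tribAux (n + 1) + tribAux n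

/-- The Tribonacci numbers `t m` for `m : ℤ`: t₋₂=0, t₋₁=1, t₀=1,
`t m = t (m-1) + t (m-2) + t (m-3)` for m ≥ 1. (Junk value 0 below -2.) -/
def t (m : ℤ) : ℕ := tribAux (m + 2).toNat

/-- Kernel numbers: k₀=0, k₁=k₂=1, `k m = k (m-1) + k (m-2) + k (m-3) - 1` for m ≥ 3. -/
def kAux : ℕ → ℕ
  | 0 => 0
  | 1 => 1
  | 2 => 1
  | n + 3 => kAux (n + 2) + kAux (n + 1) + kAux n - 1

def kker (m : ℤ) : ℕ := kAux m.toNat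

/-- `A n`: the number of distinct nonempty words w with ww a factor of 𝕋[1,n]. -/
noncomputable def A (n : ℕ) : ℕ := Nat.card {w : List TLetter // w ≠ [] ∧ (w ++ w) <:+: TPrefix n}

/-- `B n`: the number of occurrences of squares in 𝕋[1,n], i.e. of pairs (w,i) with
w nonempty, i ≥ 1, ww occurring in 𝕋 at position i and i + 2|w| - 1 ≤ n. -/
noncomputable def B (n : ℕ) : ℕ :=
  Nat.card {p : List TLetter × ℕ // p.1 ≠ [] ∧ 1 ≤ p.2 ∧
    p.2 + 2 * p.1.length - 1 ≤ n ∧ (p.1 ++ p.1) <+: (TPrefix n).drop (p.2 - 1)}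

/-- `C n`: the number of distinct nonempty words w with www a factor of 𝕋[1,n]. -/
noncomputable def C (n : ℕ) : ℕ := Nat.card {w : List TLetter // w ≠ [] ∧ (w ++ w ++ w) <:+: TPrefix n}

/-- `D n`: the number of occurrences of cubes in 𝕋[1,n], i.e. of pairs (w,i) with
w nonempty, i ≥ 1, www occurring in 𝕋 at position i and i + 3|w| - 1 ≤ n. -/
noncomputable def D (n : ℕ) : ℕ :=
  Nat.card {p : List TLetter × ℕ // p.1 ≠ [] ∧ 1 ≤ p.2 ∧
    p.2 + 3 * p.1.length - 1 ≤ n ∧ (p.1 ++ p.1 ++ p.1) <+: (TPrefix n).drop (p.2 - 1)}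

theorem Tword_length (n : ℕ) : (Tword n).length = tribAux (n + 2) := by
  have recurrence : ∀ n, Tword (n + 3) = Tword (n + 2) ++ Tword (n + 1) ++ Tword n := by
    intro n
    induction n with
    | zero => decide
    | succ n ih =>
      have h := congrArg (List.flatMap tsubst) ih
      simp only [List.flatMap_append] at h
      exact h
  induction n using Nat.strong_induction_on with
  | _ n ih =>
    match n with
    | 0 | 1 | 2 => decide
    | n + 3 =>
      rw [recurrence, List.length_append, List.length_append, ih _ (by omega), ih _ (by omega),
        ih _ (by omega)]
      rfl

theorem Tword_prefix_succ (n : ℕ) : Tword n <+: Tword (n + 1) := by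
  induction n with
  | zero => decide
  | succ n ih => exact ih.flatMap tsubst

theorem IsFactorT.of_isInfix {x y : List TLetter} (hy : IsFactorT y) (h : x <:+: y) : IsFactorT x :=
  hy.imp fun _ hm => h.trans hm

theorem IsFactorT.exists_flatMap {x : List TLetter} (h : IsFactorT x) :
    ∃ m p s, (Tword m).flatMap tsubst = p ++ x ++ s := by
  obtain ⟨m, hm⟩ := h
  obtain ⟨p, s, hs⟩ := hm.trans (Tword_prefix_succ m).isInfix
  exact ⟨m, p, s, hs.symm⟩

theorem IsFactorT.flatMap {x : List TLetter} (h : IsFactorT x) :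
    IsFactorT (x.flatMap tsubst) := by
  obtain ⟨m, p, s, h⟩ := h
  exact ⟨m + 1, p.flatMap tsubst, s.flatMap tsubst, by simp [Tword, ← h]⟩

theorem isChain_flatMap_tsubst (l : List TLetter) :
    (l.flatMap tsubst).IsChain (fun x y => x = .a ∨ y = .a) := by
  induction l with
  | nil => simp
  | cons x l ih =>
    rcases l with _ | ⟨y, l⟩
    · cases x <;> simp [tsubst]
    · cases x <;> cases y <;> simp_all [tsubst]

theorem IsFactorT.isChain {x : List TLetter} (h : IsFactorT x) :
    x.IsChain (fun x y => x = .a ∨ y = .a) := by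
  obtain ⟨m, p, s, h⟩ := h.exists_flatMap
  have hc := isChain_flatMap_tsubst (Tword m)
  rw [h] at hc
  exact hc.left_of_append.right_of_append

theorem IsFactorT.eq_a_or_eq_a {p s : List TLetter} {x y : TLetter}
    (h : IsFactorT (p ++ x :: y :: s)) : x = .a ∨ y = .a := by
  have := (h.of_isInfix (x := [x, y]) ⟨p, s, by simp⟩).isChain
  simpa using this

theorem flatMap_tsubst_ne_cons {l r : List TLetter} {d : TLetter} (hd : d ≠ .a) :
    l.flatMap tsubst ≠ d :: r := by
  rcases l with _ | ⟨x, l⟩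
  · simp
  · cases x <;> simp [tsubst, hd.symm]

theorem IsFactorT.cons_a {x : List TLetter} {d : TLetter} (h : IsFactorT (d :: x)) (hd : d ≠ .a) :
    IsFactorT (.a :: d :: x) := by
  obtain ⟨m, p, s, h⟩ := h.exists_flatMap
  rcases p.eq_nil_or_concat' with rfl | ⟨p, e, rfl⟩
  · exact absurd h (flatMap_tsubst_ne_cons hd)
  · have hf : IsFactorT (p ++ e :: d :: (x ++ s)) := ⟨m + 1, by simp [Tword, h]⟩
    obtain rfl : e = .a := hf.eq_a_or_eq_a.resolve_right hd
    exact hf.of_isInfix ⟨p, s, by simp⟩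

theorem exists_split_of_flatMap_tsubst {l p q : List TLetter}
    (h : l.flatMap tsubst = p ++ .a :: q) :
    ∃ l₁ l₂, l = l₁ ++ l₂ ∧ l₁.flatMap tsubst = p ∧ l₂.flatMap tsubst = .a :: q := by
  induction l generalizing p with
  | nil => simp at h
  | cons x l ih =>
    rcases p with _ | ⟨y, p⟩
    · exact ⟨[], x :: l, rfl, rfl, h⟩
    · have key : ∃ p', y :: p = tsubst x ++ p' ∧ l.flatMap tsubst = p' ++ .a :: q := by
        cases x
        · rcases p with _ | ⟨y', p⟩ <;> simp_all [tsubst]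
        · rcases p with _ | ⟨y', p⟩ <;> simp_all [tsubst]
        · simp_all [tsubst]
      obtain ⟨p', hp, hl⟩ := key
      obtain ⟨l₁, l₂, rfl, h₁, h₂⟩ := ih hl
      exact ⟨x :: l₁, l₂, rfl, by simp [h₁, hp], h₂⟩

theorem prefix_of_flatMap_tsubst {l y s : List TLetter}
    (h : l.flatMap tsubst = y.flatMap tsubst ++ .a :: s) : y <+: l := by
  induction y generalizing l with
  | nil => simp
  | cons x y ih =>
    have hb : ∀ (d : TLetter) (r : List TLetter), d ≠ .a →
        y.flatMap tsubst ++ .a :: s ≠ d :: r := by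
      intro d r hd
      rcases y with _ | ⟨e, y⟩
      · simp [hd.symm]
      · cases e <;> simp [tsubst, hd.symm]
    have hl : ∀ (l r : List TLetter) (d : TLetter), d ≠ .a → l.flatMap tsubst ≠ d :: r :=
      fun l r d hd => flatMap_tsubst_ne_cons hd
    rcases l with _ | ⟨x', l⟩
    · cases x <;> simp [tsubst] at h
    · cases x <;> cases x' <;> simp only [List.flatMap_cons, tsubst, List.cons_append,
        List.nil_append, List.cons.injEq, true_and, reduceCtorEq, false_and] at h
      all_goals first
        | exact List.cons_prefix_cons.2 ⟨rfl, ih h⟩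
        | exact absurd h (hl _ _ _ (by decide))
        | exact absurd h.symm (hb _ _ (by decide))

theorem IsFactorT.of_flatMap_append_a {y : List TLetter}
    (h : IsFactorT (y.flatMap tsubst ++ [.a])) : IsFactorT y := by
  obtain ⟨m, p, s, h⟩ := h.exists_flatMap
  obtain ⟨r, hr⟩ : ∃ r, y.flatMap tsubst ++ [.a] ++ s = .a :: r := by
    rcases y with _ | ⟨x, y⟩
    · simp
    · cases x <;> simp [tsubst]
  rw [List.append_assoc, hr] at h
  obtain ⟨l₁, l₂, hl, -, h₂⟩ := exists_split_of_flatMap_tsubst h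
  rw [← hr] at h₂
  have := prefix_of_flatMap_tsubst (l := l₂) (y := y) (s := s) (by simpa using h₂)
  exact ⟨m, this.isInfix.trans ⟨l₁, [], by simp [hl]⟩⟩

theorem IsFactorT.of_flatMap_concat {y : List TLetter} {z : TLetter} (hz : z ≠ .c)
    (h : IsFactorT ((y ++ [z]).flatMap tsubst)) : IsFactorT (y ++ [z]) := by
  obtain ⟨m, p, s, h⟩ := h.exists_flatMap
  obtain ⟨d, hd, hzd⟩ : ∃ d, d ≠ .a ∧ tsubst z = [.a, d] := by
    cases z <;> simp_all [tsubst]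
  obtain ⟨r, hr⟩ : ∃ r, (y ++ [z]).flatMap tsubst ++ s = .a :: r := by
    rcases y with _ | ⟨x, y⟩
    · simp [hzd]
    · cases x <;> simp [tsubst]
  rw [List.append_assoc, hr] at h
  obtain ⟨l₁, l₂, hl, -, h₂⟩ := exists_split_of_flatMap_tsubst h
  rw [← hr] at h₂
  obtain ⟨l₃, rfl⟩ := prefix_of_flatMap_tsubst (l := l₂) (y := y) (s := d :: s)
    (by simpa [hzd] using h₂)
  have h₃ : l₃.flatMap tsubst = tsubst z ++ s := by simpa using h₂
  refine ⟨m, ?_⟩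
  rcases l₃ with _ | ⟨x, l₃⟩
  · simp [hzd] at h₃
  · obtain rfl : x = z := by
      have hl : ∀ (r : List TLetter) (d : TLetter), d ≠ .a → l₃.flatMap tsubst ≠ d :: r :=
        fun r d hd => flatMap_tsubst_ne_cons hd
      rw [List.flatMap_cons] at h₃
      clear * - hl hz h₃
      cases x <;> cases z <;> simp [tsubst] at h₃ hz ⊢
      all_goals exact hl _ _ (by decide) h₃
    exact ⟨l₁, l₃, by simp [hl]⟩

theorem not_isFactorT_aaa : ¬ IsFactorT [.a, .a, .a] := fun h => by
  have h' : IsFactorT [TLetter.c, .c] := .of_flatMap_append_a h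
  simpa using h'.isChain

theorem length_le_length_flatMap_tsubst (l : List TLetter) :
    l.length ≤ (l.flatMap tsubst).length := by
  induction l with
  | nil => simp
  | cons x l ih => cases x <;> simp [tsubst] at ih ⊢ <;> omega

theorem length_lt_length_flatMap_tsubst {l : List TLetter} {z : TLetter} (hz : z ≠ .c) :
    (l ++ [z]).length < ((l ++ [z]).flatMap tsubst).length := by
  have := length_le_length_flatMap_tsubst l
  cases z <;> simp [tsubst] at this hz ⊢ <;> omega

/-- A cube lacking at most its last letter, and starting with `a`, is the image of a shorter word
of the same kind. -/
theorem IsFactorT.exists_preimage_of_almost_cube {u : List TLetter} {z : TLetter}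
    (hu : ∃ r, u = .a :: r) (h : IsFactorT (u ++ [z] ++ (u ++ [z]) ++ u)) :
    ∃ u₁ z₁, (u₁ ++ [z₁]).flatMap tsubst = u ++ [z] ∧
      (u₁ ++ [z₁]).length < (u ++ [z]).length ∧
      IsFactorT (u₁ ++ [z₁] ++ (u₁ ++ [z₁]) ++ u₁) ∧
      (z₁ ≠ .c → IsFactorT (u ++ [z] ++ (u ++ [z]) ++ (u ++ [z])) →
        IsFactorT (u₁ ++ [z₁] ++ (u₁ ++ [z₁]) ++ (u₁ ++ [z₁]))) := by
  obtain ⟨r, hr⟩ := hu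
  obtain ⟨v₁, hv₁⟩ : ∃ v₁ : List TLetter, v₁.flatMap tsubst = u ++ [z] := by
    obtain ⟨m, p, s, hm⟩ := h.exists_flatMap
    obtain ⟨-, l₂, -, -, h₂⟩ := exists_split_of_flatMap_tsubst (l := Tword m) (p := p)
      (q := r ++ [z] ++ (u ++ [z]) ++ u ++ s) (by rw [hm]; simp [hr])
    obtain ⟨v₁, -, -, hv₁, -⟩ := exists_split_of_flatMap_tsubst (l := l₂) (p := u ++ [z])
      (q := r ++ [z] ++ u ++ s) (by rw [h₂]; simp [hr])
    exact ⟨v₁, hv₁⟩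
  obtain rfl | ⟨u₁, z₁, rfl⟩ := v₁.eq_nil_or_concat'
  · simp at hv₁
  obtain ⟨u₂, e, he⟩ : ∃ u₂ e, u = u₂ ++ [e] := by
    obtain h | h := u.eq_nil_or_concat'
    · simp [hr] at h
    · exact h
  have hcube : z₁ ≠ .c → IsFactorT (u ++ [z] ++ (u ++ [z]) ++ (u ++ [z])) →
      IsFactorT (u₁ ++ [z₁] ++ (u₁ ++ [z₁]) ++ (u₁ ++ [z₁])) := by
    intro hz h
    have := IsFactorT.of_flatMap_concat (y := u₁ ++ [z₁] ++ (u₁ ++ [z₁]) ++ u₁) hz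
    simp only [← hv₁, ← List.flatMap_append] at h
    simpa using this (by simpa using h)
  have hlast : (z₁ = .c ∧ z = .a ∧ u₁.flatMap tsubst = u) ∨
      (z₁ ≠ .c ∧ e = .a ∧ u₁.flatMap tsubst = u₂) := by
    have hv₂ : u₁.flatMap tsubst ++ tsubst z₁ = u ++ [z] := by simpa using hv₁
    have hv₃ : u₁.flatMap tsubst ++ tsubst z₁ = u₂ ++ [e, z] := by rw [hv₂, he]; simp
    cases z₁
    · obtain ⟨h₁, h₂⟩ := List.append_inj' hv₃ rfl
      exact .inr ⟨by decide, by injection h₂ with h; exact h.symm, h₁⟩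
    · obtain ⟨h₁, h₂⟩ := List.append_inj' hv₃ rfl
      exact .inr ⟨by decide, by injection h₂ with h; exact h.symm, h₁⟩
    · obtain ⟨h₁, h₂⟩ := List.append_inj' hv₂ rfl
      exact .inl ⟨rfl, by injection h₂ with h; exact h.symm, h₁⟩
  obtain ⟨rfl, rfl, hu₁⟩ | ⟨hz₁, rfl, hu₁⟩ := hlast
  · have hea : e ≠ .a := by
      rintro rfl
      refine not_isFactorT_aaa (h.of_isInfix ⟨u₂, r ++ [.a] ++ u, ?_⟩)
      calc u₂ ++ [.a, .a, .a] ++ (r ++ [.a] ++ u)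
          = u₂ ++ [.a] ++ [.a] ++ (.a :: r ++ [.a]) ++ u := by simp
        _ = u ++ [.a] ++ (u ++ [.a]) ++ u := by rw [← he, ← hr]
    obtain rfl | ⟨u₃, z₃, rfl⟩ := u₁.eq_nil_or_concat'
    · simp [hr] at hu₁
    have hz₃ : z₃ ≠ .c := by
      rintro rfl
      have h1 := congrArg List.getLast? hu₁
      simp [tsubst, he] at h1
      exact hea h1.symm
    refine ⟨_, _, hv₁, ?_, ?_, hcube⟩
    · have := length_lt_length_flatMap_tsubst (l := u₃) hz₃
      rw [hu₁] at this
      simp at this ⊢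
      omega
    · have := IsFactorT.of_flatMap_concat
        (y := u₃ ++ [z₃] ++ [.c] ++ (u₃ ++ [z₃] ++ [.c]) ++ u₃) hz₃
      rw [← hv₁] at h
      replace h := hu₁.symm ▸ h
      simpa using this (by simpa using h)
  · refine ⟨u₁, z₁, hv₁, ?_, ?_, hcube⟩
    · rw [← hv₁]
      exact length_lt_length_flatMap_tsubst hz₁
    · apply IsFactorT.of_flatMap_append_a
      rw [List.flatMap_append, List.flatMap_append, hv₁, hu₁, List.append_assoc, ← he]
      exact h

theorem IsFactorT.exists_perm_Tword_of_almost_cube {u : List TLetter} {z : TLetter}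
    (h : IsFactorT (u ++ [z] ++ (u ++ [z]) ++ u)) :
    ∃ m, (u ++ [z]).Perm (Tword m) ∧
      (IsFactorT (u ++ [z] ++ (u ++ [z]) ++ (u ++ [z])) → 3 ≤ m) := by
  induction hn : (u ++ [z]).length using Nat.strong_induction_on generalizing u z with
  | _ n ih =>
  have start_a : ∀ {u : List TLetter} {z : TLetter}, (u ++ [z]).length = n → (∃ r, u = .a :: r) →
      IsFactorT (u ++ [z] ++ (u ++ [z]) ++ u) → ∃ m, (u ++ [z]).Perm (Tword m) ∧
        (IsFactorT (u ++ [z] ++ (u ++ [z]) ++ (u ++ [z])) → 3 ≤ m) := by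
    intro u z hn hu h
    obtain ⟨u₁, z₁, hv, hlen, h₁, hcube⟩ := h.exists_preimage_of_almost_cube hu
    obtain ⟨m, hm, hm3⟩ := ih _ (hn ▸ hlen) h₁ rfl
    refine ⟨m + 1, hv ▸ hm.flatMap_right tsubst, fun hc => ?_⟩
    by_contra hlt
    have hmem : z₁ ∈ Tword m := hm.subset (by simp)
    have hz₁ : z₁ ≠ .c := by
      rintro rfl
      obtain rfl | rfl : m = 0 ∨ m = 1 := by omega
      · exact absurd hmem (by decide)
      · exact absurd hmem (by decide)
    have := hm3 (hcube hz₁ hc)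
    omega
  rcases u with _ | ⟨d, u⟩
  · obtain rfl : z = .a := by
      have : IsFactorT ([] ++ z :: z :: []) := h
      simpa using this.eq_a_or_eq_a
    exact ⟨0, .refl _, fun h => absurd h not_isFactorT_aaa⟩
  by_cases hd : d = .a
  · exact start_a hn ⟨u, by rw [hd]⟩ h
  obtain rfl : z = .a := by
    have h' : IsFactorT ((d :: u) ++ z :: d :: (u ++ [z] ++ (d :: u))) := by simpa using h
    exact h'.eq_a_or_eq_a.resolve_right hd
  obtain ⟨r, e, hre⟩ : ∃ r e, d :: u = r ++ [e] := by
    obtain h | h := (d :: u).eq_nil_or_concat'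
    · simp at h
    · exact h
  rw [hre] at h hn ⊢
  have shift : ∀ x, IsFactorT (r ++ [e] ++ x) → IsFactorT (.a :: (r ++ [e] ++ x)) := by
    intro x hx
    rw [← hre] at hx ⊢
    exact hx.cons_a hd
  obtain ⟨m, hm, hm3⟩ := start_a (u := .a :: r) (z := e) (by simp at hn ⊢; omega) ⟨r, rfl⟩
    ((shift _ (by simpa using h)).of_isInfix ⟨[], [e], by simp⟩)
  refine ⟨m, (List.perm_append_comm (l₁ := r ++ [e]) (l₂ := [.a])).trans hm, fun hc => hm3 ?_⟩
  exact (shift ([.a] ++ (r ++ [e] ++ [.a]) ++ (r ++ [e] ++ [.a])) (by simpa using hc)).of_isInfix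
    ⟨[], [.a], by simp⟩

theorem isFactorT_cube_Tword (n : ℕ) :
    IsFactorT (Tword (n + 3) ++ Tword (n + 3) ++ Tword (n + 3)) := by
  induction n with
  | zero => exact ⟨7, by decide +kernel⟩
  | succ n ih => simpa [Tword] using ih.flatMap

theorem cube_lengths :
    (∀ w : List TLetter, w ≠ [] → IsFactorT (w ++ w ++ w) →
      ∃ m : ℤ, 3 ≤ m ∧ w.length = t m) ∧
    (∀ m : ℤ, 3 ≤ m →
      ∃ w : List TLetter, w ≠ [] ∧ w.length = t m ∧ IsFactorT (w ++ w ++ w)) := by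
  constructor
  · intro w hw h
    obtain rfl | ⟨u, z, rfl⟩ := w.eq_nil_or_concat'
    · exact absurd rfl hw
    obtain ⟨m, hm, hm3⟩ := IsFactorT.exists_perm_Tword_of_almost_cube
      (h.of_isInfix (x := u ++ [z] ++ (u ++ [z]) ++ u) ⟨[], [z], by simp⟩)
    refine ⟨m, by exact_mod_cast hm3 h, ?_⟩
    rw [hm.length_eq, Tword_length]
    rfl
  · intro m hm
    obtain ⟨n, rfl⟩ : ∃ n : ℕ, m = ((n + 3 : ℕ) : ℤ) := ⟨(m - 3).toNat, by omega⟩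
    have hlen : (Tword (n + 3)).length = t ((n + 3 : ℕ) : ℤ) := Tword_length _
    refine ⟨Tword (n + 3), ?_, hlen, isFactorT_cube_Tword n⟩
    obtain ⟨s, hs⟩ : [TLetter.a] <+: Tword (n + 3) := by
      induction n + 3 with
      | zero => decide
      | succ k ih => exact ih.trans (Tword_prefix_succ k)
    simp [← hs]
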